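/- Let α = (a_1, ..., a_n) with n ≥ 2 be a sharp, zero-sum-free sequence of elements of an abelian group. Then the set of sums of nonempty subsequences of α_{n−1} = (a_1, ..., a_{n−1}) is the union of the arithmetic progression {a_n, 2a_n, ..., s·a_n} for some integer s ≥ 1 (with s < ord(a_n) − 1 in case a_n has finite order) and a (possibly empty) collection of cosets of the cyclic subgroup ⟨a_n⟩ distinct from ⟨a_n⟩ itself. -/

import Mathlib

/-- The set of all subsequence sums of a list (including the sum 0 of the empty
subsequence). -/
def subSums {G : Type*} [AddCommMonoid G] [DecidableEq G] (l : List G) : Finset G :=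
  (l.sublists.map List.sum).toFinset

/-- A sequence is zero-sum-free if no nonempty subsequence sums to zero. -/
def ZeroSumFree {G : Type*} [AddCommMonoid G] (l : List G) : Prop :=
  ∀ t : List G, t.Sublist l → t ≠ [] → t.sum ≠ 0

/-- A sequence `α` of length `n` is sharp if `Σ(α) = Σ(α_{n-1}) ∪ {σ(α)}`. -/
def IsSharp {G : Type*} [AddCommMonoid G] [DecidableEq G] (l : List G) : Prop :=
  subSums l = subSums l.dropLast ∪ {l.sum}

/-- The set of sums of nonempty subsequences of a list. -/
def nonemptySubSums {G : Type*} [AddCommMonoid G] (l : List G) : Set G :=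
  {x | ∃ t : List G, t.Sublist l ∧ t ≠ [] ∧ t.sum = x}

/-- If every element of the finite set `T` other than `σ` stays in `T` after adding `c`, then the
coset of `⟨c⟩` through a point of `T` whose forward orbit avoids `σ` is contained in `T`. -/
theorem add_zsmul_mem_of_forall_ne {G : Type*} [AddCommGroup G] {T : Set G} (hT : T.Finite)
    {c σ g : G} (hstep : ∀ x ∈ T, x ≠ σ → x + c ∈ T) (hg : g ∈ T)
    (hne : ∀ k : ℕ, g + k • c ≠ σ) (z : ℤ) : g + z • c ∈ T := by
  have hmem : ∀ k : ℕ, g + k • c ∈ T := by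
    intro k
    induction k with
    | zero => simpa using hg
    | succ k ih =>
      rw [succ_nsmul, ← add_assoc]
      exact hstep _ ih (hne k)
  have hfin : IsOfFinAddOrder c := by
    by_contra h
    have hinj : Function.Injective fun k : ℕ => g + k • c := fun a b hab =>
      (injective_nsmul_iff_not_isOfFinAddOrder.mpr h) (add_left_cancel hab)
    exact Set.infinite_of_injective_forall_mem hinj hmem hT
  have hz : z • c ∈ AddSubmonoid.multiples c :=
    hfin.mem_multiples_iff_mem_zmultiples.mpr ⟨z, rfl⟩
  obtain ⟨k, hk⟩ := hz
  simpa only [← hk] using hmem k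

/-- A finite set containing `0` but not `-c`, in which every element other than `σ ≠ 0` stays
after adding `c`, consists of a progression `0, c, ..., s • c` ending at `σ` and full cosets
of `⟨c⟩`. -/
theorem exists_progression_of_add_mem {G : Type*} [AddCommGroup G] {T : Set G} (hT : T.Finite)
    {c σ : G} (hstep : ∀ x ∈ T, x ≠ σ → x + c ∈ T) (h0 : (0 : G) ∈ T) (hσT : σ ∈ T)
    (hσ : σ ≠ 0) (hc : -c ∉ T) :
    ∃ s : ℕ, 1 ≤ s ∧ (addOrderOf c ≠ 0 → s + 1 < addOrderOf c) ∧
      (∀ k ∈ Set.Icc 1 s, k • c ∈ T ∧ k • c ≠ 0) ∧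
      (∀ x ∈ T, x ≠ 0 → x ∈ AddSubgroup.zmultiples c → ∃ k ∈ Set.Icc 1 s, k • c = x) ∧
      ∀ x ∈ T, x ∉ AddSubgroup.zmultiples c → ∀ z : ℤ, x + z • c ∈ T := by
  classical
  have hreach : ∀ x ∈ T, x ∈ AddSubgroup.zmultiples c → ∃ k : ℕ, x + k • c = σ := by
    rintro x hx ⟨z, rfl⟩
    by_contra! hne
    refine hc ?_
    have := add_zsmul_mem_of_forall_ne hT hstep hx hne (-1 - z)
    rwa [← add_zsmul, add_sub_cancel, neg_one_zsmul] at this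
  have hwalk : ∀ x ∈ T, ∀ n : ℕ, (∀ k < n, x + k • c ≠ σ) → x + n • c ∈ T := by
    intro x hx n
    induction n with
    | zero => intro _; simpa using hx
    | succ n ih =>
      intro h
      rw [succ_nsmul, ← add_assoc]
      exact hstep _ (ih fun k hk => h k (by omega)) (h n (by omega))
  have hex : ∃ s : ℕ, s • c = σ := by simpa using hreach 0 h0 (zero_mem _)
  obtain ⟨s, hs, hmin⟩ : ∃ s : ℕ, s • c = σ ∧ ∀ k < s, k • c ≠ σ :=
    ⟨Nat.find hex, Nat.find_spec hex, fun k hk => Nat.find_min hex hk⟩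
  refine ⟨s, ?_, ?_, ?_, ?_, ?_⟩
  · rcases Nat.eq_zero_or_pos s with rfl | h
    · exact absurd (by simpa using hs.symm) hσ
    · exact h
  · intro hm
    have hlt : s < addOrderOf c := by
      by_contra! h
      refine hmin (s - addOrderOf c) (by omega) ?_
      rw [← hs]
      conv_rhs => rw [← Nat.sub_add_cancel h, add_nsmul, addOrderOf_nsmul_eq_zero, add_zero]
    rcases Nat.lt_or_ge (s + 1) (addOrderOf c) with h | h
    · exact h
    · refine absurd hσT ?_
      have : (s + 1) • c = 0 := by
        rw [show s + 1 = addOrderOf c by omega, addOrderOf_nsmul_eq_zero]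
      rw [succ_nsmul, hs] at this
      rwa [eq_neg_of_add_eq_zero_left this]
  · rintro k ⟨hk1, hks⟩
    constructor
    · simpa using hwalk 0 h0 k fun j hj => by simpa using hmin j (by omega)
    · intro hk
      refine hmin (s - k) (by omega) ?_
      rw [← hs]
      conv_rhs => rw [← Nat.sub_add_cancel hks, add_nsmul, hk, add_zero]
  · intro x hx hx0 hxc
    have hex' := hreach x hx hxc
    obtain ⟨k, hk, hkmin⟩ : ∃ k : ℕ, x + k • c = σ ∧ ∀ j < k, x + j • c ≠ σ :=
      ⟨Nat.find hex', Nat.find_spec hex', fun j hj => Nat.find_min hex' hj⟩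
    rcases Nat.lt_or_ge s k with hsk | hks
    · obtain ⟨d, rfl⟩ : ∃ d, k = s + (d + 1) := ⟨k - s - 1, by omega⟩
      rw [← hs, add_nsmul, succ_nsmul, add_left_comm, add_eq_left, ← add_assoc] at hk
      have hd := hwalk x hx d fun j hj => hkmin j (by omega)
      rw [eq_neg_of_add_eq_zero_left hk] at hd
      exact absurd hd hc
    · obtain ⟨d, rfl⟩ := Nat.exists_eq_add_of_le' hks
      rw [← hs, add_nsmul, add_left_inj] at hk
      refine ⟨d, ⟨?_, by omega⟩, hk.symm⟩
      rcases Nat.eq_zero_or_pos d with rfl | h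
      · exact absurd (by simpa using hk) hx0
      · exact h
  · intro x hx hxc
    refine add_zsmul_mem_of_forall_ne hT hstep hx fun k hk => hxc ?_
    rw [eq_sub_of_add_eq hk, ← hs]
    exact sub_mem (AddSubgroup.nsmul_mem_zmultiples c s) (AddSubgroup.nsmul_mem_zmultiples c k)

theorem mem_subSums {G : Type*} [AddCommMonoid G] [DecidableEq G] {l : List G} {x : G} :
    x ∈ subSums l ↔ ∃ t : List G, t.Sublist l ∧ t.sum = x := by
  simp [subSums]

/-- **Claim (Smith–Freeze, Savchev–Chen, part (a)).** If `α = l ++ [c]` (with `n ≥ 2`,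
i.e. `l ≠ []`) is a sharp zero-sum-free sequence, then the set of nonempty subsequence
sums of `α_{n-1} = l` is the union of the arithmetic progression `{c, 2c, ..., s·c}`
for some `s ≥ 1` (with `s < ord(c) − 1` if `c` has finite order) and a possibly empty
collection of cosets of `⟨c⟩` distinct from `⟨c⟩` itself. -/
theorem sharp_structure {G : Type*} [AddCommGroup G] [DecidableEq G]
    (l : List G) (c : G) (hl : l ≠ [])
    (hzsf : ZeroSumFree (l ++ [c])) (hsharp : IsSharp (l ++ [c])) :
    ∃ (s : ℕ) (S : Set G),
      1 ≤ s ∧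
      (addOrderOf c ≠ 0 → s + 1 < addOrderOf c) ∧
      (∀ g ∈ S, g ∉ AddSubgroup.zmultiples c) ∧
      nonemptySubSums l =
        ((fun k : ℕ => k • c) '' Set.Icc 1 s) ∪
          ⋃ g ∈ S, ((g + ·) '' (AddSubgroup.zmultiples c : Set G)) := by
  have hmem : ∀ x, x ∈ nonemptySubSums l ↔ x ∈ subSums l ∧ x ≠ 0 := by
    intro x
    rw [mem_subSums]
    constructor
    · rintro ⟨t, ht, hne, rfl⟩
      exact ⟨⟨t, ht, rfl⟩, hzsf t (ht.trans (List.sublist_append_left l [c])) hne⟩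
    · rintro ⟨⟨t, ht, rfl⟩, hx⟩
      exact ⟨t, ht, fun h => hx (by simp [h]), rfl⟩
  have hstep : ∀ x ∈ (subSums l : Set G), x ≠ l.sum → x + c ∈ (subSums l : Set G) := by
    intro x hx hne
    obtain ⟨t, ht, rfl⟩ := mem_subSums.mp hx
    have h : t.sum + c ∈ subSums (l ++ [c]) :=
      mem_subSums.mpr ⟨t ++ [c], ht.append_right [c], by simp⟩
    rw [hsharp] at h
    simpa [hne] using h
  have hc : -c ∉ (subSums l : Set G) := by
    intro h
    obtain ⟨t, ht, hsum⟩ := mem_subSums.mp h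
    exact hzsf (t ++ [c]) (ht.append_right [c]) (by simp) (by simp [hsum])
  obtain ⟨s, hs, hord, hprog, hcyc, hcoset⟩ :=
    exists_progression_of_add_mem (subSums l).finite_toSet hstep
      (mem_subSums.mpr ⟨[], List.nil_sublist l, rfl⟩)
      (mem_subSums.mpr ⟨l, List.Sublist.refl l, rfl⟩)
      (hzsf l (List.sublist_append_left l [c]) hl) hc
  refine ⟨s, {x | x ∈ subSums l ∧ x ∉ AddSubgroup.zmultiples c}, hs, hord, fun g hg => hg.2, ?_⟩
  ext x
  simp only [hmem, Set.mem_union, Set.mem_iUnion, Set.mem_image, exists_prop]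
  constructor
  · rintro ⟨hx, hx0⟩
    by_cases hxc : x ∈ AddSubgroup.zmultiples c
    · exact Or.inl (hcyc x hx hx0 hxc)
    · exact Or.inr ⟨x, ⟨hx, hxc⟩, 0, zero_mem _, add_zero x⟩
  · rintro (⟨k, hk, rfl⟩ | ⟨g, ⟨hg, hgc⟩, _, ⟨z, rfl⟩, rfl⟩)
    · exact hprog k hk
    · refine ⟨hcoset g hg hgc z, fun h => hgc ?_⟩
      rw [eq_neg_of_add_eq_zero_left h]
      exact neg_mem ⟨z, rfl⟩
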